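/- arXiv:2008.12508 — 2 statements merged into one kernel-verified Lean document; each statement's English description precedes it below -/
import Mathlib

section
/- Let G = (V, E) be a finite bipartite graph with weight function w. If an edge e_p ∈ E has strictly positive price of absence with respect to G, then every MCM M of G that is a solution to the SeqBAP contains e_p, i.e., e_p ∈ M. -/
open Finset

variable {V : Type*} [Fintype V] [DecidableEq V]

/-- `M` is a matching: no vertex is incident to more than one edge of `M`. -/
def IsMatching (M : Finset (Sym2 V)) : Prop :=
  ∀ v : V, (M.filter (fun e => v ∈ e)).card ≤ 1

/-- `M` is a maximum cardinality matching of the graph with edge set `E`. -/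
def IsMCM (E M : Finset (Sym2 V)) : Prop :=
  M ⊆ E ∧ IsMatching M ∧ ∀ M' ⊆ E, IsMatching M' → M'.card ≤ M.card

/-- The cardinality of a maximum cardinality matching of `E`. -/
noncomputable def mcmCard (E : Finset (Sym2 V)) : ℕ :=
  sSup {k : ℕ | ∃ M ⊆ E, IsMatching M ∧ M.card = k}

/-- The largest weight of an edge of `M` (`max_{e ∈ M} w(e)`). -/
noncomputable def maxW (w : Sym2 V → ℝ) (M : Finset (Sym2 V)) : ℝ :=
  sSup (w '' (M : Set (Sym2 V)))

/-- The bottleneck weight `W(G) = min over MCMs M of max_{e ∈ M} w(e)`. -/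
noncomputable def botW (w : Sym2 V → ℝ) (E : Finset (Sym2 V)) : ℝ :=
  sInf (maxW w '' {M : Finset (Sym2 V) | IsMCM E M})

/-- `M` is a bottleneck assignment of `E`. -/
def IsBotAssignment (w : Sym2 V → ℝ) (E M : Finset (Sym2 V)) : Prop :=
  IsMCM E M ∧ maxW w M = botW w E

/-- Edge `e` has strictly positive price of absence in `E`. -/
def PosPrice (w : Sym2 V → ℝ) (E : Finset (Sym2 V)) (e : Sym2 V) : Prop :=
  mcmCard (E.erase e) < mcmCard E ∨ botW w E < botW w (E.erase e)

/-- The price of absence `P(G,e)` as an extended real (`⊤` if removing `e`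
reduces the MCM cardinality). -/
noncomputable def price (w : Sym2 V → ℝ) (E : Finset (Sym2 V)) (e : Sym2 V) : EReal :=
  if mcmCard (E.erase e) < mcmCard E then ⊤
  else ((botW w (E.erase e) - botW w E : ℝ) : EReal)

/-- `E` is the edge set of a bipartite graph on disjoint parts `A` and `B`. -/
def IsBipartiteOn (A B : Finset V) (E : Finset (Sym2 V)) : Prop :=
  Disjoint A B ∧ ∀ e ∈ E, ∃ a ∈ A, ∃ b ∈ B, e = s(a, b)

/-- `P` is a path between `x` and `y` all of whose edges lie in `E`. -/
def IsPathBetween (E P : Finset (Sym2 V)) (x y : V) : Prop :=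
  ∃ (l : ℕ) (v : Fin (l + 1) → V), 0 < l ∧ Function.Injective v ∧
    v 0 = x ∧ v (Fin.last l) = y ∧
    (∀ k : Fin l, s(v k.castSucc, v k.succ) ∈ E) ∧
    P = Finset.image (fun k : Fin l => s(v k.castSucc, v k.succ)) Finset.univ

/-- `P` is alternating relative to the matching `M`. -/
def IsAlternating (M P : Finset (Sym2 V)) : Prop :=
  ∀ v : V, ((P ∩ M).filter (fun e => v ∈ e)).card ≤ 1 ∧
    ((P \ M).filter (fun e => v ∈ e)).card ≤ 1

/-- Vertex `v` is free relative to the matching `M`. -/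
def IsFree (M : Finset (Sym2 V)) (v : V) : Prop := ∀ e ∈ M, v ∉ e

/-- `P` is an augmenting path relative to `M` contained in the edge set `E`. -/
def IsAugPath (E M P : Finset (Sym2 V)) : Prop :=
  ∃ x y : V, IsPathBetween E P x y ∧ IsAlternating M P ∧ IsFree M x ∧ IsFree M y

/-- The matching-sublevel set `ψ(G,M)`. -/
noncomputable def sublevel (w : Sym2 V → ℝ) (E M : Finset (Sym2 V)) : Finset (Sym2 V) :=
  E.filter (fun e => w e ≤ maxW w M)

/-- The strict matching-sublevel set `ψ_S(G,M)`. -/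
noncomputable def strictSublevel (w : Sym2 V → ℝ) (E M : Finset (Sym2 V)) : Finset (Sym2 V) :=
  E.filter (fun e => w e < maxW w M)

/-- `ec` is a critical bottleneck edge of `E` relative to the MCM `M`. -/
noncomputable def IsCritical (w : Sym2 V → ℝ) (E M : Finset (Sym2 V)) (ec : Sym2 V) : Prop :=
  ec ∈ M ∧ (∀ e ∈ M, w e ≤ w ec) ∧
  ¬ ∃ P, IsAugPath ((M ∪ strictSublevel w E M).erase ec) (M.erase ec) P

/-- The set `L(M)` of maximum-weight edges of `M`. -/
noncomputable def maxEdges (w : Sym2 V → ℝ) (M : Finset (Sym2 V)) : Finset (Sym2 V) :=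
  M.filter (fun e => ∀ e' ∈ M, w e' ≤ w e)

/-- The edge set of the subgraph of `E` induced by agent set `Ak` and task set `Bk`. -/
def induced (E : Finset (Sym2 V)) (Ak Bk : Finset V) : Finset (Sym2 V) :=
  E.filter (fun e => ∃ a ∈ Ak, ∃ b ∈ Bk, e = s(a, b))

/-- Witness data of a solution to the SeqBAP: selected edges `{i_k, j_k}`,
vertex sets `A^k`, `B^k` (0-indexed) and bottleneck assignments `M^k` of the
induced graphs `G^k`. -/
structure SeqBAPData (w : Sym2 V → ℝ) (A B : Finset V) (E : Finset (Sym2 V)) (n : ℕ) where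
  i : Fin n → V
  j : Fin n → V
  Ak : Fin n → Finset V
  Bk : Fin n → Finset V
  Mk : Fin n → Finset (Sym2 V)
  hij : ∀ k, i k ∈ A ∧ j k ∈ B
  hedsitinct : ∀ k l, s(i k, j k) = s(i l, j l) → k = l
  hA0 : ∀ h : 0 < n, Ak ⟨0, h⟩ = A
  hB0 : ∀ h : 0 < n, Bk ⟨0, h⟩ = B
  hAk : ∀ (k : ℕ) (h : k + 1 < n),
    Ak ⟨k + 1, h⟩ = (Ak ⟨k, by omega⟩).erase (i ⟨k, by omega⟩)
  hBk : ∀ (k : ℕ) (h : k + 1 < n),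
    Bk ⟨k + 1, h⟩ = (Bk ⟨k, by omega⟩).erase (j ⟨k, by omega⟩)
  hMk : ∀ k, IsBotAssignment w (induced E (Ak k) (Bk k)) (Mk k)
  hmaxedge : ∀ k, s(i k, j k) ∈ maxEdges w (Mk k)
  hprice : ∀ k, ∀ e ∈ maxEdges w (Mk k),
    price w (induced E (Ak k) (Bk k)) e ≤ price w (induced E (Ak k) (Bk k)) (s(i k, j k))

/-- `M` is a solution to the SeqBAP for the bipartite graph with parts `A`, `B`
and edge set `E`. -/
def IsSeqBAPSol (w : Sym2 V → ℝ) (A B : Finset V) (E M : Finset (Sym2 V)) : Prop :=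
  IsMCM E M ∧ ∃ (n : ℕ) (d : SeqBAPData w A B E n),
    M.card = n ∧ M = Finset.image (fun k => s(d.i k, d.j k)) Finset.univ

/-- The weights of `M` sorted in nonincreasing order (the tuple `T(M)`). -/
noncomputable def sortedW (w : Sym2 V → ℝ) (M : Finset (Sym2 V)) : List ℝ :=
  ((M.val.map w).sort (· ≤ ·)).reverse

/-- The `k`-th entry `T_k(M)` (0-indexed) of the sorted weight tuple. -/
noncomputable def Tk (w : Sym2 V → ℝ) (M : Finset (Sym2 V)) (k : ℕ) : ℝ :=
  (sortedW w M).getD k 0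

/-- `M` is a solution to the LexBAP for the graph with edge set `E`. -/
def IsLexBAPSol (w : Sym2 V → ℝ) (E M : Finset (Sym2 V)) : Prop :=
  IsMCM E M ∧ ∀ M', IsMCM E M' → sortedW w M' ≠ sortedW w M →
    ∃ k < M.card, Tk w M k < Tk w M' k ∧ ∀ l < k, Tk w M l = Tk w M' l

theorem isMatching_iff' (M : Finset (Sym2 V)) :
    IsMatching M ↔ ∀ v : V, ∀ e ∈ M, ∀ f ∈ M, v ∈ e → v ∈ f → e = f := by
  unfold IsMatching
  refine forall_congr' fun v => ?_
  rw [Finset.card_le_one]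
  constructor
  · intro h e he f hf h1 h2
    exact h e (Finset.mem_filter.2 ⟨he, h1⟩) f (Finset.mem_filter.2 ⟨hf, h2⟩)
  · intro h e he f hf
    rw [Finset.mem_filter] at he hf
    exact h e he.1 f hf.1 he.2 hf.2

theorem IsMatching.mono' {M N : Finset (Sym2 V)} (h : IsMatching N) (hs : M ⊆ N) :
    IsMatching M := by
  rw [isMatching_iff'] at h ⊢
  intro v e he f hf
  exact h v e (hs he) f (hs hf)

theorem le_maxW' (w : Sym2 V → ℝ) {M : Finset (Sym2 V)} {e : Sym2 V} (he : e ∈ M) :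
    w e ≤ maxW w M :=
  le_csSup ((M.finite_toSet.image w).bddAbove) ⟨e, he, rfl⟩

theorem maxW_le' (w : Sym2 V → ℝ) {M : Finset (Sym2 V)} (hM : M.Nonempty) {c : ℝ}
    (h : ∀ e ∈ M, w e ≤ c) : maxW w M ≤ c := by
  apply csSup_le
  · obtain ⟨e, he⟩ := hM
    exact ⟨w e, e, he, rfl⟩
  · rintro _ ⟨e, he, rfl⟩
    exact h e he

theorem botW_le' (w : Sym2 V → ℝ) {E M : Finset (Sym2 V)} (h : IsMCM E M) :
    botW w E ≤ maxW w M :=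
  csInf_le ((Set.toFinite _).image _).bddBelow ⟨M, h, rfl⟩

theorem mcmCard_eq' {E M : Finset (Sym2 V)} (h : IsMCM E M) : mcmCard E = M.card := by
  refine IsGreatest.csSup_eq ⟨⟨M, h.1, h.2.1, rfl⟩, ?_⟩
  rintro k ⟨N, hN, hm, rfl⟩
  exact h.2.2 N hN hm

/-- One step of the sequential procedure keeps the remainder of an MCM an MCM. -/
theorem step_isMCM {A B A' B' : Finset V} {E M : Finset (Sym2 V)} {i j : V}
    (hAB : Disjoint A B) (hA : A' ⊆ A) (hB : B' ⊆ B) (hi : i ∈ A) (hj : j ∈ B)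
    (hM : IsMCM (induced E A' B') M) (he : s(i, j) ∈ M) :
    IsMCM (induced E (A'.erase i) (B'.erase j)) (M.erase s(i, j)) := by
  have hmat := (isMatching_iff' M).1 hM.2.1
  refine ⟨?_, hM.2.1.mono' (Finset.erase_subset _ _), ?_⟩
  · intro f hf
    obtain ⟨hne, hfM⟩ := Finset.mem_erase.1 hf
    obtain ⟨hfE, a, ha, b, hb, rfl⟩ := Finset.mem_filter.1 (hM.1 hfM)
    refine Finset.mem_filter.2 ⟨hfE, a, Finset.mem_erase.2 ⟨?_, ha⟩, b,
      Finset.mem_erase.2 ⟨?_, hb⟩, rfl⟩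
    · rintro rfl
      exact hne (hmat a _ hfM _ he (by simp) (by simp))
    · rintro rfl
      exact hne (hmat b _ hfM _ he (by simp) (by simp))
  · intro N hN hNm
    have hNi : ∀ f ∈ N, i ∉ f ∧ j ∉ f := by
      intro f hf
      obtain ⟨-, a, ha, b, hb, rfl⟩ := Finset.mem_filter.1 (hN hf)
      rw [Finset.mem_erase] at ha hb
      have h1 : i ≠ b := fun h => Finset.disjoint_left.1 hAB hi (h ▸ hB hb.2)
      have h2 : j ≠ a := fun h => Finset.disjoint_left.1 hAB (hA ha.2) (h ▸ hj)
      simp only [Sym2.mem_iff, not_or]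
      exact ⟨⟨ha.1.symm, h1⟩, h2, hb.1.symm⟩
    have hnot : s(i, j) ∉ N := fun h => (hNi _ h).1 (by simp)
    have hno : ∀ v, v ∈ s(i, j) → ∀ f ∈ N, v ∉ f := by
      intro v hv f hf
      rcases Sym2.mem_iff.1 hv with rfl | rfl
      · exact (hNi f hf).1
      · exact (hNi f hf).2
    have key := hM.2.2 (insert s(i, j) N) ?_ ?_
    · rw [Finset.card_insert_of_notMem hnot] at key
      rw [Finset.card_erase_of_mem he]
      omega
    · intro f hf
      rcases Finset.mem_insert.1 hf with rfl | hf
      · exact hM.1 he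
      · obtain ⟨hfE, a, ha, b, hb, rfl⟩ := Finset.mem_filter.1 (hN hf)
        exact Finset.mem_filter.2 ⟨hfE, a, Finset.mem_of_mem_erase ha, b,
          Finset.mem_of_mem_erase hb, rfl⟩
    · rw [isMatching_iff'] at hNm ⊢
      intro v f hf g hg hvf hvg
      rcases Finset.mem_insert.1 hf with rfl | hf <;> rcases Finset.mem_insert.1 hg with rfl | hg
      · rfl
      · exact absurd hvg (hno v hvf g hg)
      · exact absurd hvf (hno v hvg f hf)
      · exact hNm v f hf g hg hvf hvg

theorem seq_bound {w : Sym2 V → ℝ} {A B : Finset V} {E : Finset (Sym2 V)} {n : ℕ}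
    (hbip : IsBipartiteOn A B E) (d : SeqBAPData w A B E n) :
    ∀ (k : ℕ) (h : k < n), d.Ak ⟨k, h⟩ ⊆ A ∧ d.Bk ⟨k, h⟩ ⊆ B ∧
      maxW w (d.Mk ⟨k, h⟩) ≤ botW w E := by
  intro k
  induction k with
  | zero =>
    intro h
    have hE : induced E A B = E := Finset.filter_true_of_mem hbip.2
    have := (d.hMk ⟨0, h⟩).2
    rw [d.hA0 h, d.hB0 h, hE] at this
    exact ⟨(d.hA0 h).le, (d.hB0 h).le, this.le⟩
  | succ k ih =>
    intro h
    obtain ⟨hA, hB, hW⟩ := ih (by omega)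
    have hmem : ∀ k, s(d.i k, d.j k) ∈ d.Mk k := fun k => (Finset.mem_filter.1 (d.hmaxedge k)).1
    have hs := step_isMCM hbip.1 hA hB (d.hij _).1 (d.hij _).2 (d.hMk ⟨k, by omega⟩).1 (hmem _)
    have hk := d.hMk ⟨k + 1, h⟩
    rw [d.hAk k h, d.hBk k h] at hk
    refine ⟨?_, ?_, ?_⟩
    · rw [d.hAk k h]; exact (Finset.erase_subset _ _).trans hA
    · rw [d.hBk k h]; exact (Finset.erase_subset _ _).trans hB
    · rw [hk.2]
      refine (botW_le' w hs).trans ((maxW_le' w ?_ ?_).trans hW)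
      · rw [← Finset.card_pos]
        exact lt_of_lt_of_le (Finset.card_pos.2 ⟨_, hmem ⟨k + 1, h⟩⟩)
          (hs.2.2 _ hk.1.1 hk.1.2.1)
      · intro e he
        exact le_maxW' w (Finset.mem_of_mem_erase he)

/-- An edge with strictly positive price of absence belongs to every MCM
that is a solution to the SeqBAP. -/
theorem posPrice_mem_every_seqBAP_sol
    (A B : Finset V) (E : Finset (Sym2 V)) (w : Sym2 V → ℝ)
    (hbip : IsBipartiteOn A B E)
    (ep : Sym2 V) (hep : ep ∈ E) (hpos : PosPrice w E ep) :
    ∀ M : Finset (Sym2 V), IsSeqBAPSol w A B E M → ep ∈ M := by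
  rintro M ⟨hM, n, d, -, hMd⟩
  by_contra hnot
  have hM' : IsMCM (E.erase ep) M := by
    refine ⟨fun e he => Finset.mem_erase.2 ⟨?_, hM.1 he⟩, hM.2.1, fun N hN hm =>
      hM.2.2 N (hN.trans (Finset.erase_subset _ _)) hm⟩
    rintro rfl
    exact hnot he
  rcases hpos with h | h
  · rw [mcmCard_eq' hM, mcmCard_eq' hM'] at h
    exact lt_irrefl _ h
  · have hne : M.Nonempty := by
      rw [← Finset.card_pos]
      have := hM.2.2 {ep} (by simpa using hep) ((isMatching_iff' _).2 (by simp))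
      simpa using this
    refine absurd h (not_lt.2 ((botW_le' w hM').trans (maxW_le' w hne ?_)))
    intro e he
    rw [hMd] at he
    obtain ⟨k, -, rfl⟩ := Finset.mem_image.1 he
    exact (le_maxW' w (Finset.mem_filter.1 (d.hmaxedge k)).1).trans
      (seq_bound hbip d k.1 k.2).2.2
end

section
/- Let G be a finite bipartite graph with weight function w and let M = {{i_1,j_1},...,{i_n,j_n}} be a solution to the SeqBAP for G, with associated graphs G^k. If every sequentially selected edge {i_k,j_k} has strictly positive price of absence in its respective graph G^k for all k ∈ {1,...,n}, then M is the unique solution to the LexBAP for G. -/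
open Finset

variable {V : Type*} [Fintype V] [DecidableEq V]

theorem isMatching_iff_aux {V : Type*} [Fintype V] [DecidableEq V] (M : Finset (Sym2 V)) :
    IsMatching M ↔ ∀ v : V, ∀ e ∈ M, ∀ f ∈ M, v ∈ e → v ∈ f → e = f := by
  unfold IsMatching
  simp only [Finset.card_le_one, Finset.mem_filter]
  constructor
  · intro h v e he f hf hv hv'
    exact h v e ⟨he, hv⟩ f ⟨hf, hv'⟩
  · rintro h v e ⟨he, hv⟩ f ⟨hf, hv'⟩
    exact h v e he f hf hv hv'

theorem mcmCard_eq_aux {V : Type*} [Fintype V] [DecidableEq V] {E N : Finset (Sym2 V)}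
    (h : IsMCM E N) : mcmCard E = N.card := by
  unfold mcmCard
  apply le_antisymm
  · refine csSup_le ⟨_, N, h.1, h.2.1, rfl⟩ ?_
    rintro k ⟨M, h1, h2, rfl⟩
    exact h.2.2 M h1 h2
  · refine le_csSup ⟨N.card, ?_⟩ ⟨N, h.1, h.2.1, rfl⟩
    rintro k ⟨M, h1, h2, rfl⟩
    exact h.2.2 M h1 h2

theorem botW_le_aux {V : Type*} [Fintype V] [DecidableEq V] (w : Sym2 V → ℝ)
    {E N : Finset (Sym2 V)} (h : IsMCM E N) : botW w E ≤ maxW w N := by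
  unfold botW
  exact csInf_le ((Set.toFinite _).image _).bddBelow ⟨N, h, rfl⟩

theorem maxW_le_aux {V : Type*} [Fintype V] [DecidableEq V] (w : Sym2 V → ℝ)
    {N : Finset (Sym2 V)} (h : N.Nonempty) (c : ℝ) (hc : ∀ e ∈ N, w e ≤ c) : maxW w N ≤ c := by
  unfold maxW
  apply csSup_le
  · exact (Finset.coe_nonempty.2 h).image _
  · rintro _ ⟨e, he, rfl⟩
    exact hc e he

theorem maxW_eq_aux {V : Type*} [Fintype V] [DecidableEq V] (w : Sym2 V → ℝ)
    {N : Finset (Sym2 V)} {e : Sym2 V} (h : e ∈ maxEdges w N) : maxW w N = w e := by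
  simp only [maxEdges, Finset.mem_filter] at h
  apply le_antisymm (maxW_le_aux w ⟨e, h.1⟩ _ h.2)
  unfold maxW
  exact le_csSup ((N.finite_toSet).image _).bddAbove ⟨e, h.1, rfl⟩

/-- An MCM avoiding an edge of strictly positive price contains a heavier edge. -/
theorem posPrice_aux {V : Type*} [Fintype V] [DecidableEq V] (w : Sym2 V → ℝ)
    {E N M : Finset (Sym2 V)} {e : Sym2 V} (hp : PosPrice w E e) (hM : IsBotAssignment w E M)
    (he : e ∈ maxEdges w M) (hN : IsMCM E N) (hne : e ∉ N) : ∃ g ∈ N, w e < w g := by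
  have hN' : IsMCM (E.erase e) N := by
    refine ⟨?_, hN.2.1, fun P hP hPm => hN.2.2 P (hP.trans (Finset.erase_subset _ _)) hPm⟩
    intro f hf
    rw [Finset.mem_erase]
    exact ⟨fun h => hne (h ▸ hf), hN.1 hf⟩
  rcases hp with hp | hp
  · rw [mcmCard_eq_aux hN, mcmCard_eq_aux hN'] at hp
    omega
  · have h1 := botW_le_aux w hN'
    have h2 : botW w E = w e := by rw [← hM.2, maxW_eq_aux w he]
    by_contra hcon
    push Not at hcon
    have hMe : e ∈ M := (Finset.mem_filter.1 he).1
    have hcard := hN.2.2 M hM.1.1 hM.1.2.1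
    have hNe : N.Nonempty := by
      rw [← Finset.card_pos]
      exact lt_of_lt_of_le (Finset.card_pos.2 ⟨e, hMe⟩) hcard
    have := maxW_le_aux w hNe _ hcon
    linarith

theorem sortedW_eq_aux {V : Type*} [Fintype V] [DecidableEq V] (w : Sym2 V → ℝ)
    (N C : Finset (Sym2 V)) (hC : C ⊆ N) (hle : ∀ e ∈ C, ∀ f ∈ N, f ∉ C → w f ≤ w e) :
    sortedW w N = sortedW w C ++ sortedW w (N \ C) := by
  have hs : ∀ P : Finset (Sym2 V), (sortedW w P).Pairwise (· ≥ ·) := by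
    intro P
    unfold sortedW
    rw [List.pairwise_reverse]
    exact Multiset.pairwise_sort _ _
  have hc : ∀ P : Finset (Sym2 V), ((sortedW w P : List ℝ) : Multiset ℝ) = P.val.map w := by
    intro P
    unfold sortedW
    rw [Multiset.coe_reverse, Multiset.sort_eq]
  have hm : ∀ (P : Finset (Sym2 V)) (x : ℝ), x ∈ sortedW w P → ∃ e ∈ P, w e = x := by
    intro P x hx
    rw [← Multiset.mem_coe, hc, Multiset.mem_map] at hx
    exact hx
  have hperm : (sortedW w N).Perm (sortedW w C ++ sortedW w (N \ C)) := by
    rw [← Multiset.coe_eq_coe, ← Multiset.coe_add, hc, hc, hc, ← Multiset.map_add]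
    congr 1
    have := Finset.sdiff_union_of_subset hC
    rw [Finset.sdiff_val, add_comm, Multiset.sub_add_cancel (Finset.val_le_iff.2 hC)]
  refine hperm.eq_of_pairwise (fun a b _ _ h1 h2 => le_antisymm h2 h1) (hs N) ?_
  rw [List.pairwise_append]
  refine ⟨hs _, hs _, ?_⟩
  intro a ha b hb
  obtain ⟨e, he, rfl⟩ := hm _ _ ha
  obtain ⟨f, hf, rfl⟩ := hm _ _ hb
  rw [Finset.mem_sdiff] at hf
  exact hle e he f hf.1 hf.2

theorem lex_aux {V : Type*} [Fintype V] [DecidableEq V] (w : Sym2 V → ℝ)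
    (M N : Finset (Sym2 V)) (hcard : M.card = N.card) (f : Sym2 V) (hfN : f ∈ N) (hfM : f ∉ M)
    (h1 : ∀ e ∈ M, w f ≤ w e → e ∈ N) (h2 : ∀ e ∈ N, e ∉ M → w e ≤ w f) :
    ∃ k < M.card, Tk w M k < Tk w N k ∧ ∀ l < k, Tk w M l = Tk w N l := by
  have hm : ∀ (P : Finset (Sym2 V)) (x : ℝ), x ∈ sortedW w P ↔ ∃ e ∈ P, w e = x := by
    intro P x
    simp [sortedW]
  have hlen : ∀ P : Finset (Sym2 V), (sortedW w P).length = P.card := by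
    intro P
    simp [sortedW]
  have hs : ∀ P : Finset (Sym2 V), (sortedW w P).Pairwise (· ≥ ·) := by
    intro P
    unfold sortedW
    rw [List.pairwise_reverse]
    exact Multiset.pairwise_sort _ _
  set C := M.filter (fun e => w f ≤ w e) with hCdef
  have hCM : C ⊆ M := Finset.filter_subset _ _
  have hCN : C ⊆ N := by
    intro e he
    rw [hCdef, Finset.mem_filter] at he
    exact h1 e he.1 he.2
  have hfC : f ∉ C := fun h => hfM (hCM h)
  have eM : sortedW w M = sortedW w C ++ sortedW w (M \ C) := by
    apply sortedW_eq_aux w M C hCM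
    intro e he g hg hgC
    rw [hCdef, Finset.mem_filter] at he hgC
    push Not at hgC
    exact (hgC hg).le.trans he.2
  have hNC : ∀ g ∈ N, g ∉ C → w g ≤ w f := by
    intro g hg hgC
    by_cases hgM : g ∈ M
    · rw [hCdef, Finset.mem_filter] at hgC
      push Not at hgC
      exact (hgC hgM).le
    · exact h2 g hg hgM
  have eN : sortedW w N = sortedW w C ++ sortedW w (N \ C) := by
    apply sortedW_eq_aux w N C hCN
    intro e he g hg hgC
    rw [hCdef, Finset.mem_filter] at he
    exact (hNC g hg hgC).trans he.2
  have hCcard : C.card < M.card := by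
    rw [hcard]
    exact Finset.card_lt_card ⟨hCN, fun h => hfC (h hfN)⟩
  refine ⟨C.card, hCcard, ?_, ?_⟩
  · unfold Tk
    rw [eM, eN, List.getD_append_right _ _ _ _ (by rw [hlen]),
      List.getD_append_right _ _ _ _ (by rw [hlen]), hlen, Nat.sub_self]
    have a1 : ∃ x ∈ sortedW w (M \ C), (sortedW w (M \ C)).getD 0 0 = x := by
      have : 0 < (sortedW w (M \ C)).length := by
        rw [hlen, Finset.card_sdiff_of_subset hCM]; omega
      match h : sortedW w (M \ C), this with
      | a :: l, _ => simp
    have a2 : w f ≤ (sortedW w (N \ C)).getD 0 0 := by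
      have hf : w f ∈ sortedW w (N \ C) :=
        (hm _ _).2 ⟨f, Finset.mem_sdiff.2 ⟨hfN, hfC⟩, rfl⟩
      have hso := hs (N \ C)
      match h : sortedW w (N \ C), hf, hso with
      | a :: l, hf, hso =>
        rw [List.pairwise_cons] at hso
        simp only [List.getD_cons_zero]
        rcases List.mem_cons.1 hf with h' | h'
        · exact h'.le
        · exact hso.1 _ h'
    obtain ⟨x, hx, hx'⟩ := a1
    rw [hx']
    obtain ⟨e, he, rfl⟩ := (hm _ _).1 hx
    rw [Finset.mem_sdiff, hCdef, Finset.mem_filter] at he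
    have : ¬ w f ≤ w e := fun h => he.2 ⟨he.1, h⟩
    linarith
  · intro l hl
    unfold Tk
    rw [eM, eN, List.getD_append _ _ _ _ (by rw [hlen]; exact hl),
      List.getD_append _ _ _ _ (by rw [hlen]; exact hl)]

/-- Key combinatorial step. -/
theorem key_aux {V : Type*} [Fintype V] [DecidableEq V]
    (A B : Finset V) (E : Finset (Sym2 V)) (w : Sym2 V → ℝ)
    (hbip : IsBipartiteOn A B E)
    (M : Finset (Sym2 V)) (hMCM : IsMCM E M)
    (n : ℕ) (d : SeqBAPData w A B E n)
    (hMeq : M = Finset.image (fun k => s(d.i k, d.j k)) Finset.univ)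
    (hpos : ∀ k : Fin n, PosPrice w (induced E (d.Ak k) (d.Bk k)) s(d.i k, d.j k))
    (N : Finset (Sym2 V)) (hN : IsMCM E N) (hne : N ≠ M) :
    ∃ k < M.card, Tk w M k < Tk w N k ∧ ∀ l < k, Tk w M l = Tk w N l := by
  obtain ⟨hdisj, hE⟩ := hbip
  have hcardN : M.card = N.card :=
    le_antisymm (hN.2.2 M hMCM.1 hMCM.2.1) (hMCM.2.2 N hN.1 hN.2.1)
  set e : Fin n → Sym2 V := fun k => s(d.i k, d.j k) with hedef
  have heM : ∀ k, e k ∈ M := fun k => by rw [hMeq]; exact Finset.mem_image_of_mem _ (mem_univ k)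
  have heM' : ∀ f ∈ M, ∃ k, e k = f := fun f hf => by
    rw [hMeq] at hf
    obtain ⟨k, -, hk⟩ := Finset.mem_image.1 hf
    exact ⟨k, hk⟩
  -- description of the vertex sets
  have hAmem : ∀ (k : ℕ) (hk : k < n) (v : V),
      v ∈ d.Ak ⟨k, hk⟩ ↔ v ∈ A ∧ ∀ l : Fin n, (l : ℕ) < k → v ≠ d.i l := by
    intro k
    induction k with
    | zero => intro hk v; rw [d.hA0 hk]; simp
    | succ k ih =>
      intro hk v
      rw [d.hAk k hk, Finset.mem_erase, ih (by omega)]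
      constructor
      · rintro ⟨h1, h2, h3⟩
        refine ⟨h2, fun l hl => ?_⟩
        rcases Nat.lt_succ_iff_lt_or_eq.1 hl with h | h
        · exact h3 l h
        · have : l = ⟨k, by omega⟩ := Fin.ext h
          rw [this]; exact h1
      · rintro ⟨h1, h2⟩
        exact ⟨h2 ⟨k, by omega⟩ (Nat.lt_succ_self k), h1, fun l hl => h2 l (by omega)⟩
  have hBmem : ∀ (k : ℕ) (hk : k < n) (v : V),
      v ∈ d.Bk ⟨k, hk⟩ ↔ v ∈ B ∧ ∀ l : Fin n, (l : ℕ) < k → v ≠ d.j l := by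
    intro k
    induction k with
    | zero => intro hk v; rw [d.hB0 hk]; simp
    | succ k ih =>
      intro hk v
      rw [d.hBk k hk, Finset.mem_erase, ih (by omega)]
      constructor
      · rintro ⟨h1, h2, h3⟩
        refine ⟨h2, fun l hl => ?_⟩
        rcases Nat.lt_succ_iff_lt_or_eq.1 hl with h | h
        · exact h3 l h
        · have : l = ⟨k, by omega⟩ := Fin.ext h
          rw [this]; exact h1
      · rintro ⟨h1, h2⟩
        exact ⟨h2 ⟨k, by omega⟩ (Nat.lt_succ_self k), h1, fun l hl => h2 l (by omega)⟩
  have hAB : ∀ a ∈ A, ∀ b ∈ B, a ≠ b := fun a ha b hb h =>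
    Finset.disjoint_left.1 hdisj ha (h ▸ hb)
  have hind : ∀ (k : Fin n) (f : Sym2 V), f ∈ induced E (d.Ak k) (d.Bk k) ↔
      f ∈ E ∧ ∀ l : Fin n, l < k → ∀ v ∈ e l, v ∉ f := by
    intro k f
    unfold induced
    rw [Finset.mem_filter]
    constructor
    · rintro ⟨h1, a, ha, b, hb, rfl⟩
      refine ⟨h1, fun l hl v hv hvf => ?_⟩
      have ha' := (hAmem k k.2 a).1 ha
      have hb' := (hBmem k k.2 b).1 hb
      have hi := (d.hij l).1
      have hj := (d.hij l).2
      rw [hedef, Sym2.mem_iff] at hv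
      rw [Sym2.mem_iff] at hvf
      rcases hv with rfl | rfl <;> rcases hvf with h | h
      · exact ha'.2 l hl h.symm
      · exact hAB _ hi _ hb'.1 h
      · exact hAB _ ha'.1 _ hj h.symm
      · exact hb'.2 l hl h.symm
    · rintro ⟨h1, h2⟩
      obtain ⟨a, ha, b, hb, rfl⟩ := hE f h1
      refine ⟨h1, a, ?_, b, ?_, rfl⟩
      · refine (hAmem k k.2 a).2 ⟨ha, fun l hl h => ?_⟩
        exact h2 l hl a (by rw [hedef, h]; exact Sym2.mem_mk_left _ _) (Sym2.mem_mk_left _ _)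
      · refine (hBmem k k.2 b).2 ⟨hb, fun l hl h => ?_⟩
        exact h2 l hl b (by rw [hedef, h]; exact Sym2.mem_mk_right _ _) (Sym2.mem_mk_right _ _)
  -- the initial segments
  let C : Fin n → Finset (Sym2 V) := fun k => (univ.filter (fun l => l < k)).image e
  have hCmem : ∀ k f, f ∈ C k ↔ ∃ l, l < k ∧ e l = f := by
    intro k f; simp [C]
  have hCM : ∀ k, C k ⊆ M := by
    intro k f hf
    obtain ⟨l, -, rfl⟩ := (hCmem k f).1 hf
    exact heM l
  have hMm := (isMatching_iff_aux M).1 hMCM.2.1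
  -- extension by an initial segment
  have hext : ∀ k P, P ⊆ induced E (d.Ak k) (d.Bk k) → IsMatching P →
      (P ∪ C k) ⊆ E ∧ IsMatching (P ∪ C k) ∧ (P ∪ C k).card = P.card + (C k).card := by
    intro k P hP hPm
    have hx : ∀ f ∈ P, ∀ g ∈ C k, ∀ v, v ∈ g → v ∉ f := by
      intro f hf g hg v hv
      obtain ⟨l, hl, rfl⟩ := (hCmem k g).1 hg
      exact ((hind k f).1 (hP hf)).2 l hl v hv
    refine ⟨?_, ?_, ?_⟩
    · intro f hf
      rcases Finset.mem_union.1 hf with h | h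
      · exact ((hind k f).1 (hP h)).1
      · exact hMCM.1 (hCM k h)
    · rw [isMatching_iff_aux] at hPm ⊢
      intro v f hf g hg hvf hvg
      rcases Finset.mem_union.1 hf with h | h <;> rcases Finset.mem_union.1 hg with h' | h'
      · exact hPm v f h g h' hvf hvg
      · exact absurd hvf (hx f h g h' v hvg)
      · exact absurd hvg (hx g h' f h v hvf)
      · exact hMm v f (hCM k h) g (hCM k h') hvf hvg
    · apply Finset.card_union_of_disjoint
      rw [Finset.disjoint_left]
      intro f hf hfC
      obtain ⟨l, hl, hl'⟩ := (hCmem k f).1 hfC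
      have hmem : d.i l ∈ f := by rw [← hl']; exact Sym2.mem_mk_left _ _
      exact hx f hf f hfC _ hmem hmem
  -- restriction
  have hres : ∀ k P, IsMCM E P → C k ⊆ P →
      IsMCM (induced E (d.Ak k) (d.Bk k)) (P \ C k) := by
    intro k P hP hCP
    have hPm := (isMatching_iff_aux P).1 hP.2.1
    refine ⟨?_, ?_, ?_⟩
    · intro f hf
      rw [Finset.mem_sdiff] at hf
      refine (hind k f).2 ⟨hP.1 hf.1, fun l hl v hv hvf => ?_⟩
      have hlC : e l ∈ C k := (hCmem k _).2 ⟨l, hl, rfl⟩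
      have := hPm v f hf.1 (e l) (hCP hlC) hvf hv
      exact hf.2 (this ▸ hlC)
    · rw [isMatching_iff_aux]
      intro v f hf g hg
      exact hPm v f (Finset.mem_sdiff.1 hf).1 g (Finset.mem_sdiff.1 hg).1
    · intro Q hQ hQm
      obtain ⟨h1, h2, h3⟩ := hext k Q hQ hQm
      have := hP.2.2 _ h1 h2
      rw [Finset.card_sdiff_of_subset hCP]
      omega
  have hmax : ∀ k, e k ∈ d.Mk k ∧ ∀ f ∈ d.Mk k, w f ≤ w (e k) := by
    intro k
    have := d.hmaxedge k
    simp only [maxEdges, Finset.mem_filter] at this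
    exact this
  have hbot : ∀ k, botW w (induced E (d.Ak k) (d.Bk k)) = w (e k) := by
    intro k
    rw [← (d.hMk k).2, maxW_eq_aux w (d.hmaxedge k)]
  -- weights of selected edges are nonincreasing
  have hstep : ∀ (k : ℕ) (hk : k + 1 < n), w (e ⟨k + 1, hk⟩) ≤ w (e ⟨k, by omega⟩) := by
    intro k hk
    set k0 : Fin n := ⟨k, by omega⟩
    set k1 : Fin n := ⟨k + 1, hk⟩
    obtain ⟨h1, h2, h3⟩ := hext k0 (d.Mk k0) (d.hMk k0).1.1 (d.hMk k0).1.2.1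
    have hM0 := hres k0 M hMCM (hCM k0)
    have hP : IsMCM E (d.Mk k0 ∪ C k0) := by
      refine ⟨h1, h2, fun Q hQ hQm => ?_⟩
      have ha := hMCM.2.2 Q hQ hQm
      have hb := (d.hMk k0).1.2.2 _ hM0.1 hM0.2.1
      rw [Finset.card_sdiff_of_subset (hCM k0)] at hb
      omega
    have hsub : C k1 ⊆ d.Mk k0 ∪ C k0 := by
      intro f hf
      obtain ⟨l, hl, rfl⟩ := (hCmem k1 f).1 hf
      have hl' : (l : ℕ) < k + 1 := hl
      rcases Nat.lt_succ_iff_lt_or_eq.1 hl' with h | h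
      · exact Finset.mem_union_right _ ((hCmem _ _).2 ⟨l, h, rfl⟩)
      · have : l = k0 := Fin.ext h
        rw [this]
        exact Finset.mem_union_left _ (hmax k0).1
    have hR := hres k1 _ hP hsub
    have hRc := hR.2.2 _ (d.hMk k1).1.1 (d.hMk k1).1.2.1
    have hRne : ((d.Mk k0 ∪ C k0) \ C k1).Nonempty := by
      rw [← Finset.card_pos]
      exact lt_of_lt_of_le (Finset.card_pos.2 ⟨_, (hmax k1).1⟩) hRc
    rw [← hbot k1]
    refine (botW_le_aux w hR).trans (maxW_le_aux w hRne _ ?_)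
    intro f hf
    rw [Finset.mem_sdiff, Finset.mem_union] at hf
    rcases hf.1 with h | h
    · exact (hmax k0).2 f h
    · exfalso
      apply hf.2
      obtain ⟨l, hl, rfl⟩ := (hCmem k0 f).1 h
      exact (hCmem k1 _).2 ⟨l, lt_trans hl (Nat.lt_succ_self k), rfl⟩
  have hanti : ∀ (k m : ℕ) (hm : k + m < n), w (e ⟨k + m, hm⟩) ≤ w (e ⟨k, by omega⟩) := by
    intro k m
    induction m with
    | zero => intro hm; exact le_rfl
    | succ m ih => intro hm; exact (hstep (k + m) hm).trans (ih (by omega))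
  have hanti' : ∀ k l : Fin n, k ≤ l → w (e l) ≤ w (e k) := by
    intro k l hkl
    have hkl' : (k : ℕ) ≤ l := hkl
    have h := hanti k (l - k) (by omega)
    have : (⟨(k : ℕ) + (l - k), by omega⟩ : Fin n) = l := Fin.ext (by simp; omega)
    rwa [this] at h
  -- first selected edge missing from N
  have hex : ∃ k, e k ∉ N := by
    by_contra hcon
    push Not at hcon
    have hsub : M ⊆ N := by
      intro f hf
      obtain ⟨k, rfl⟩ := heM' f hf
      exact hcon k
    exact hne (Finset.eq_of_subset_of_card_le hsub hcardN.ge).symm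
  obtain ⟨k, hk, hkmin⟩ : ∃ k, e k ∉ N ∧ ∀ l, l < k → e l ∈ N := by
    have hne' : (univ.filter (fun k => e k ∉ N)).Nonempty := by
      obtain ⟨k, hk⟩ := hex
      exact ⟨k, by simp [hk]⟩
    refine ⟨(univ.filter (fun k => e k ∉ N)).min' hne', ?_, ?_⟩
    · have := Finset.min'_mem _ hne'
      exact (Finset.mem_filter.1 this).2
    · intro l hl
      by_contra hcon
      have := Finset.min'_le (univ.filter (fun k => e k ∉ N)) l (by simp [hcon])
      exact absurd hl (not_lt.2 this)
  have hCN : C k ⊆ N := by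
    intro f hf
    obtain ⟨l, hl, rfl⟩ := (hCmem k f).1 hf
    exact hkmin l hl
  obtain ⟨g, hg, hgw⟩ := posPrice_aux w (hpos k) (d.hMk k) (d.hmaxedge k) (hres k N hN hCN)
    (fun h => hk (Finset.mem_sdiff.1 h).1)
  rw [Finset.mem_sdiff] at hg
  have hgM : g ∉ M := by
    intro h
    obtain ⟨l, rfl⟩ := heM' g h
    rcases lt_or_ge l k with hl | hl
    · exact hg.2 ((hCmem k _).2 ⟨l, hl, rfl⟩)
    · exact absurd (hanti' k l hl) (not_le.2 hgw)
  obtain ⟨f, hf, hfmax⟩ := Finset.exists_max_image (N \ M) w ⟨g, Finset.mem_sdiff.2 ⟨hg.1, hgM⟩⟩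
  have hfg := hfmax g (Finset.mem_sdiff.2 ⟨hg.1, hgM⟩)
  rw [Finset.mem_sdiff] at hf
  refine lex_aux w M N hcardN f hf.1 hf.2 ?_ (fun x hx hxM => hfmax x (Finset.mem_sdiff.2 ⟨hx, hxM⟩))
  intro x hx hfx
  obtain ⟨l, rfl⟩ := heM' x hx
  rcases lt_or_ge l k with hl | hl
  · exact hkmin l hl
  · have h1 := hanti' k l hl
    have h2 : w (e k) < w g := hgw
    linarith

/-- For a SeqBAP solution `M` with associated data, if all sequentially
selected edges have strictly positive price of absence in their respective graphs `G^k`,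
then `M` is the unique solution to the LexBAP. -/
theorem all_posPrice_implies_unique_lexBAP_sol
    (A B : Finset V) (E : Finset (Sym2 V)) (w : Sym2 V → ℝ)
    (hbip : IsBipartiteOn A B E)
    (M : Finset (Sym2 V)) (hMCM : IsMCM E M)
    (n : ℕ) (d : SeqBAPData w A B E n)
    (hcard : M.card = n)
    (hMeq : M = Finset.image (fun k => s(d.i k, d.j k)) Finset.univ)
    (hpos : ∀ k : Fin n, PosPrice w (induced E (d.Ak k) (d.Bk k)) s(d.i k, d.j k)) :
    IsLexBAPSol w E M ∧ ∀ M' : Finset (Sym2 V), IsLexBAPSol w E M' → M' = M := by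
  have key := key_aux A B E w hbip M hMCM n d hMeq hpos
  refine ⟨⟨hMCM, fun N hN hne => ?_⟩, fun N hN => ?_⟩
  · exact key N hN (fun h => hne (by rw [h]))
  · by_contra hne
    obtain ⟨k, hk, h1, h2⟩ := key N hN.1 hne
    have hs : sortedW w M ≠ sortedW w N := by
      intro h
      unfold Tk at h1
      rw [h] at h1
      exact lt_irrefl _ h1
    obtain ⟨k', hk', h1', h2'⟩ := hN.2 M hMCM hs
    rcases lt_trichotomy k k' with h | h | h
    · have := h2' k h; linarith
    · subst h; linarith
    · have := h2 k' h; linarith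
end
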